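/- Let d ≥ 1. Let C be a real symmetric positive semidefinite d×d matrix with eigendecomposition C = U Λ Uᵀ, where U is a real orthogonal d×d matrix and Λ = diag(λ₁, …, λ_d) with λ₁ ≥ λ₂ ≥ ⋯ ≥ λ_d ≥ 0. Let E = diag(μ₁, …, μ_d) be a real diagonal d×d matrix with 0 ≤ μ₁ ≤ μ₂ ≤ ⋯ ≤ μ_d. Then for every real orthogonal d×d matrix R, tr(Uᵀ C U E) ≤ tr(Rᵀ C R E); that is, R = U minimizes the frozen-error surrogate objective R ↦ tr(Rᵀ C R E) over the orthogonal group. -/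

import Mathlib

open Matrix Finset

/-- Averaging the product of two antivarying families against a doubly stochastic matrix can only
increase the diagonal sum. -/
theorem Antivary.sum_mul_le_sum_doublyStochastic {n : Type*} [Fintype n] [DecidableEq n]
    {f g : n → ℝ} (hfg : Antivary f g) {S : Matrix n n ℝ} (hS : S ∈ doublyStochastic ℝ n) :
    ∑ i, f i * g i ≤ ∑ i, ∑ j, S i j * (f i * g j) := by
  obtain ⟨w, hw0, hw1, rfl⟩ := exists_eq_sum_perm_of_mem_doublyStochastic hS
  have hperm (σ : Equiv.Perm n) :
      ∑ i, ∑ j, σ.permMatrix ℝ i j * (f i * g j) = ∑ i, f i * g (σ i) := by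
    simp [Equiv.Perm.permMatrix, PEquiv.toMatrix_apply]
  calc ∑ i, f i * g i = ∑ σ, w σ * ∑ i, f i * g i := by rw [← Finset.sum_mul, hw1, one_mul]
    _ ≤ ∑ σ, w σ * ∑ i, f i * g (σ i) := Finset.sum_le_sum fun σ _ ↦
        mul_le_mul_of_nonneg_left hfg.sum_mul_le_sum_mul_comp_perm (hw0 σ)
    _ = _ := by
      simp_rw [← hperm, Matrix.sum_apply, Matrix.smul_apply, smul_eq_mul, Finset.sum_mul,
        Finset.mul_sum, ← mul_assoc]
      rw [Finset.sum_comm]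
      exact Finset.sum_congr rfl fun i _ ↦ Finset.sum_comm

/-- The entrywise square of a real orthogonal matrix is doubly stochastic. -/
theorem Matrix.sq_mem_doublyStochastic_of_transpose_mul_self {n : Type*} [Fintype n]
    [DecidableEq n] {V : Matrix n n ℝ} (hV : Vᵀ * V = 1) :
    Matrix.of (fun i j ↦ V i j ^ 2) ∈ doublyStochastic ℝ n := by
  have hV' : V * Vᵀ = 1 := mul_eq_one_comm.mp hV
  refine mem_doublyStochastic_iff_sum.mpr ⟨fun i j ↦ sq_nonneg _, fun i ↦ ?_, fun j ↦ ?_⟩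
  · simpa [Matrix.mul_apply, sq] using congrFun₂ hV' i i
  · simpa [Matrix.mul_apply, sq] using congrFun₂ hV j j

/-- The trace of a diagonal matrix conjugated by `V`, against another diagonal matrix. -/
theorem Matrix.trace_transpose_mul_diagonal_mul_mul_diagonal {n : Type*} [Fintype n]
    [DecidableEq n] (V : Matrix n n ℝ) (f g : n → ℝ) :
    (Vᵀ * diagonal f * V * diagonal g).trace = ∑ i, ∑ j, V i j ^ 2 * (f i * g j) := by
  rw [Finset.sum_comm]
  simp only [Matrix.trace, Matrix.diag_apply, Matrix.mul_diagonal, Matrix.mul_apply (N := V),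
    Matrix.transpose_apply, Finset.sum_mul]
  exact Finset.sum_congr rfl fun j _ ↦ Finset.sum_congr rfl fun i _ ↦ by ring

/-- For `C = U Λ Uᵀ` PSD with descending nonnegative eigenvalues and
`E = diag μ` with ascending nonnegative entries, `R = U` minimizes the frozen-error
surrogate `R ↦ tr(Rᵀ C R E)` over the orthogonal group. -/
theorem oscar_rotation_optimality (d : ℕ) (hd : 1 ≤ d)
    (C U : Matrix (Fin d) (Fin d) ℝ) (lam mu : Fin d → ℝ)
    (hC : C.PosSemidef)
    (hU : Uᵀ * U = 1)
    (hdecomp : C = U * Matrix.diagonal lam * Uᵀ)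
    (hlam : ∀ i j : Fin d, i ≤ j → lam j ≤ lam i)
    (hlam0 : ∀ i, 0 ≤ lam i)
    (hmu : ∀ i j : Fin d, i ≤ j → mu i ≤ mu j)
    (hmu0 : ∀ i, 0 ≤ mu i) :
    ∀ R : Matrix (Fin d) (Fin d) ℝ, Rᵀ * R = 1 →
      (Uᵀ * C * U * Matrix.diagonal mu).trace ≤ (Rᵀ * C * R * Matrix.diagonal mu).trace := by
  intro R hR
  have hU' : U * Uᵀ = 1 := mul_eq_one_comm.mp hU
  have hV : (Uᵀ * R)ᵀ * (Uᵀ * R) = 1 := by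
    rw [transpose_mul, transpose_transpose, Matrix.mul_assoc, ← Matrix.mul_assoc U, hU',
      Matrix.one_mul, hR]
  have hleft : Uᵀ * C * U = diagonal lam := by
    rw [hdecomp, Matrix.mul_assoc, Matrix.mul_assoc, hU, Matrix.mul_one, ← Matrix.mul_assoc, hU,
      Matrix.one_mul]
  have hright : Rᵀ * C * R = (Uᵀ * R)ᵀ * diagonal lam * (Uᵀ * R) := by
    simp only [hdecomp, transpose_mul, transpose_transpose, Matrix.mul_assoc]
  have hanti : Antivary lam mu := Antitone.antivary (fun i j ↦ hlam i j) (fun i j ↦ hmu i j)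
  rw [hleft, hright, trace_transpose_mul_diagonal_mul_mul_diagonal, diagonal_mul_diagonal,
    trace_diagonal]
  exact hanti.sum_mul_le_sum_doublyStochastic (sq_mem_doublyStochastic_of_transpose_mul_self hV)
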